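/- Every nonempty product K_1 K_2 ⋯ K_n with each K_i ∈ {A_4, A_4ᵀ, A_5, A_6} (where A_4 = [[3,2],[-2,-1]], A_5 = [[5,2],[2,1]], A_6 = [[5,-2],[-2,1]]) is a decreasing matrix, i.e. its entries [[a,c],[b,d]] satisfy |a| > |b| > |d| and |a| > |c| > |d|. -/

import Mathlib

open Matrix

theorem col_aux (L : List (Matrix (Fin 2) (Fin 2) ℤ)) (hne : L ≠ [])
    (hL : ∀ K ∈ L, K = !![3, 2; -2, -1] ∨ K = !![3, -2; 2, -1] ∨
          K = !![5, 2; 2, 1] ∨ K = !![5, -2; -2, 1]) :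
    ∀ j, |L.prod 1 j| < |L.prod 0 j| := by
  induction L with
  | nil => exact absurd rfl hne
  | cons K L ih =>
    intro j
    have hK := hL K (by simp)
    by_cases h : L = []
    · subst h
      rcases hK with h | h | h | h <;> subst h <;> fin_cases j <;> simp
    · have h1 := ih h (fun M hM => hL M (by simp [hM])) j
      rw [List.prod_cons, Matrix.mul_apply, Matrix.mul_apply, Fin.sum_univ_two, Fin.sum_univ_two]
      generalize L.prod 0 j = x at *
      generalize L.prod 1 j = y at *
      rcases hK with h | h | h | h <;> subst h <;> simp <;> clear ih hL <;>
        simp only [abs] at * <;> grind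

/-- Every nonempty product of matrices from {A₄, A₄ᵀ, A₅, A₆} is decreasing. -/
theorem stmt_6 (L : List (Matrix (Fin 2) (Fin 2) ℤ)) (hne : L ≠ [])
    (hL : ∀ K ∈ L, K = !![3, 2; -2, -1] ∨ K = !![3, -2; 2, -1] ∨
          K = !![5, 2; 2, 1] ∨ K = !![5, -2; -2, 1]) :
    |L.prod 0 0| > |L.prod 1 0| ∧ |L.prod 1 0| > |L.prod 1 1| ∧
      |L.prod 0 0| > |L.prod 0 1| ∧ |L.prod 0 1| > |L.prod 1 1| := by
  have h1 := col_aux L hne hL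
  have h2 := col_aux (L.map transpose).reverse (by simpa using hne) (by
    intro K hK
    simp only [List.mem_reverse, List.mem_map] at hK
    obtain ⟨M, hM, rfl⟩ := hK
    rcases hL M hM with h | h | h | h <;> subst h
    · right; left; ext i j; fin_cases i <;> fin_cases j <;> rfl
    · left; ext i j; fin_cases i <;> fin_cases j <;> rfl
    · right; right; left; ext i j; fin_cases i <;> fin_cases j <;> rfl
    · right; right; right; ext i j; fin_cases i <;> fin_cases j <;> rfl)
  rw [← Matrix.transpose_list_prod] at h2
  exact ⟨h1 0, h2 1, h2 0, h1 1⟩
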